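/- Suppose the noises satisfy the Bernstein condition: there exist B > 0 and F_{t-1}-measurable σ_t ≥ 0 such that E[|ε_t|^m | F_{t-1}] ≤ (1/2) m! B^{m−2} σ_t² for all integers m ≥ 2 and all t ≥ 1. Let W_t = Σ_{i=1}^t ‖G_i‖² σ_i². Then, almost surely on the event {sup_t W_t = ∞}, limsup_{t→∞} ‖(ρI + V_t)^{-1/2} M_t‖ / sqrt(2 W_t log log W_t) ≤ 1. -/

import Mathlib

open MeasureTheory Filter Real
open scoped RealInnerProductSpace

noncomputable def outerProd {H : Type*} [NormedAddCommGroup H] [InnerProductSpace ℝ H]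
    (x : H) : H →L[ℝ] H :=
  (innerSL ℝ x).smulRight x


/-- chord inequality -/
lemma cosh_chord {s α β p q : ℝ} (hp : 0 ≤ p) (hq : 0 ≤ q) (hpq : p + q = 1)
    (hs : s ^ 2 = p * α ^ 2 + q * β ^ 2) : cosh s ≤ p * cosh α + q * cosh β := by
  refine hasSum_le (fun n => ?_) (Real.hasSum_cosh s)
    (((Real.hasSum_cosh α).mul_left p).add ((Real.hasSum_cosh β).mul_left q))
  have h := (convexOn_pow n).2 (sq_nonneg α : α^2 ∈ Set.Ici 0) (sq_nonneg β : β^2 ∈ Set.Ici 0) hp hq hpq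
  simp only [smul_eq_mul] at h
  rw [← hs, ← pow_mul, ← pow_mul, ← pow_mul] at h
  have : (0:ℝ) < ((2 * n).factorial : ℝ) := by positivity
  rw [← mul_div_assoc, ← mul_div_assoc, ← add_div]
  gcongr

lemma cosh_norm_add {H : Type*} [NormedAddCommGroup H] [InnerProductSpace ℝ H] (u v : H) :
    cosh ‖u + v‖ ≤ cosh ‖u‖ + sinh ‖u‖ / ‖u‖ * ⟪u, v⟫ +
      cosh ‖u‖ * (exp ‖v‖ - 1 - ‖v‖) := by
  rcases eq_or_ne u 0 with rfl | hu
  · simp only [zero_add, norm_zero, cosh_zero, sinh_zero, inner_zero_left]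
    have h1 : ‖v‖ ≤ sinh ‖v‖ := Real.self_le_sinh_iff.2 (norm_nonneg v)
    have h2 := Real.cosh_add_sinh ‖v‖
    linarith
  rcases eq_or_ne v 0 with rfl | hv
  · simp
  have ha : 0 < ‖u‖ := norm_pos_iff.2 hu
  have hb : 0 < ‖v‖ := norm_pos_iff.2 hv
  set a := ‖u‖ with hadef
  set b := ‖v‖ with hbdef
  obtain ⟨τ, hτ⟩ : ∃ τ : ℝ, ⟪u, v⟫ = τ * (a * b) :=
    ⟨⟪u, v⟫ / (a * b), by field_simp⟩
  have hτ1 : |τ| ≤ 1 := by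
    have := abs_real_inner_le_norm u v
    rw [hτ, abs_mul, abs_of_pos (mul_pos ha hb), ← hadef, ← hbdef] at this
    have h0 := mul_pos ha hb
    nlinarith
  obtain ⟨h1, h2⟩ := abs_le.1 hτ1
  have hch := cosh_chord (s := ‖u + v‖) (α := a + b) (β := a - b) (p := (1 + τ) / 2)
    (q := (1 - τ) / 2) (by linarith) (by linarith) (by ring) (by
      rw [norm_add_sq_real, hτ]; ring)
  rw [Real.cosh_add, Real.cosh_sub] at hch
  have h3 : b ≤ sinh b := Real.self_le_sinh_iff.2 hb.le
  have h4 := Real.cosh_add_sinh b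
  have h5 : sinh a / a * ⟪u, v⟫ = τ * b * sinh a := by
    rw [hτ]; field_simp
  rw [h5, ← h4]
  have h6 : sinh a < cosh a := Real.sinh_lt_cosh a
  have h7 : 0 < sinh a := Real.sinh_pos_iff.2 ha
  have h8 : τ * sinh a ≤ cosh a := by nlinarith
  nlinarith [mul_nonneg (sub_nonneg.2 h8) (sub_nonneg.2 h3)]

/-- Deterministic part -/
lemma log_asymp {η : ℝ} (hη : 1 < η) :
    ∀ᶠ k : ℕ in atTop, log (2 * (k:ℝ) ^ η) ≤ η ^ 2 * log (k * log η) := by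
  have h0 : Tendsto (fun k : ℕ => log (k : ℝ)) atTop atTop :=
    Real.tendsto_log_atTop.comp tendsto_natCast_atTop_atTop
  have hl : 0 < log η := Real.log_pos hη
  filter_upwards [h0.eventually_ge_atTop ((log 2 - η ^ 2 * log (log η)) / (η ^ 2 - η)),
    eventually_gt_atTop 0] with k hk hk0
  have hk0' : (0:ℝ) < k := by exact_mod_cast hk0
  rw [Real.log_mul two_ne_zero (by positivity), Real.log_rpow hk0', Real.log_mul hk0'.ne' hl.ne']
  rw [div_le_iff₀ (by nlinarith)] at hk
  nlinarith

lemma lam_tendsto {η : ℝ} (hη : 1 < η) :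
    Tendsto (fun k : ℕ => √(2 * log (2 * (k:ℝ) ^ η) / η ^ k)) atTop (nhds 0) := by
  have key : Tendsto (fun k : ℕ => 2 * log (2 * (k:ℝ) ^ η) / η ^ k) atTop (nhds 0) := by
    have h1 : Tendsto (fun k : ℕ => (k:ℝ) ^ 1 / η ^ k) atTop (nhds 0) :=
      tendsto_pow_const_div_const_pow_of_one_lt 1 hη
    have h0 : Tendsto (fun k : ℕ => (k:ℝ) ^ 0 / η ^ k) atTop (nhds 0) :=
      tendsto_pow_const_div_const_pow_of_one_lt 0 hη
    have h2 : Tendsto (fun k : ℕ => 2 * log 2 * ((k:ℝ) ^ 0 / η ^ k) + 2 * η * ((k:ℝ) ^ 1 / η ^ k))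
        atTop (nhds 0) := by simpa using (h0.const_mul (2 * log 2)).add (h1.const_mul (2 * η))
    refine tendsto_of_tendsto_of_tendsto_of_le_of_le' tendsto_const_nhds h2 ?_ ?_
    · filter_upwards [eventually_ge_atTop 1] with k hk
      have hk' : (1:ℝ) ≤ k := by exact_mod_cast hk
      have := Real.one_le_rpow hk' (by linarith : 0 ≤ η)
      have : 0 ≤ log (2 * (k:ℝ) ^ η) := Real.log_nonneg (by linarith)
      positivity
    · filter_upwards [eventually_ge_atTop 1] with k hk
      have hk' : (1:ℝ) ≤ k := by exact_mod_cast hk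
      have hk0 : (0:ℝ) < k := by linarith
      rw [Real.log_mul two_ne_zero (by positivity), Real.log_rpow hk0, ← mul_div_assoc,
        ← mul_div_assoc, ← add_div]
      have := Real.log_le_self hk0.le
      gcongr
      nlinarith
  simpa using key.sqrt

set_option maxHeartbeats 1000000 in
lemma det_bound {η B : ℝ} (hη : 1 < η) (W z : ℕ → ℝ) (hW : Tendsto W atTop atTop)
    (h : ∀ᶠ k : ℕ in atTop, ∀ t, √(2 * log (2 * (k:ℝ) ^ η) / η ^ k) * z t ≤
      √(2 * log (2 * (k:ℝ) ^ η) / η ^ k) ^ 2 /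
        (2 * (1 - √(2 * log (2 * (k:ℝ) ^ η) / η ^ k) * B)) * W t + log (2 * (k:ℝ) ^ η)) :
    ∀ᶠ t in atTop, z t ≤ η ^ 3 * √(2 * W t * log (log (W t))) ∧ 0 < 2 * W t * log (log (W t)) := by
  have hl : 0 < log η := Real.log_pos hη
  have hB : ∀ᶠ k : ℕ in atTop, √(2 * log (2 * (k:ℝ) ^ η) / η ^ k) * B < 1 - 1 / η := by
    have := (lam_tendsto hη).mul_const B
    rw [zero_mul] at this
    refine this.eventually_lt_const ?_
    rw [sub_pos, div_lt_one (by linarith)]; exact hη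
  have hk : Tendsto (fun t => ⌊log (W t) / log η⌋₊) atTop atTop :=
    tendsto_nat_floor_atTop.comp ((Real.tendsto_log_atTop.comp hW).atTop_div_const hl)
  filter_upwards [hk.eventually h, hk.eventually hB, hk.eventually (log_asymp hη),
    hk.eventually (eventually_ge_atTop 1), hW.eventually_ge_atTop (exp 2)] with t h1 h2 h3 h4 h5
  set k := ⌊log (W t) / log η⌋₊ with hkdef
  set w := W t
  set ℓ := log (2 * (k:ℝ) ^ η) with hℓ
  set lam := √(2 * ℓ / η ^ k) with hlam
  set r := η ^ k with hr
  have hk' : (1:ℝ) ≤ k := by exact_mod_cast h4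
  have hw0 : 0 < w := lt_of_lt_of_le (exp_pos 2) h5
  have hlw : 2 ≤ log w := (Real.le_log_iff_exp_le hw0).2 h5
  have hr0 : 0 < r := by positivity
  have hℓ0 : 0 < ℓ := by
    refine Real.log_pos ?_
    have := Real.one_le_rpow hk' (by linarith : 0 ≤ η)
    linarith
  have hfl : (k:ℝ) * log η ≤ log w := by
    rw [← le_div_iff₀ hl]
    exact Nat.floor_le (div_nonneg (by linarith) hl.le)
  have hfl2 : log w < (k + 1) * log η := by
    rw [← div_lt_iff₀ hl]; exact Nat.lt_floor_add_one _
  have hrw : r ≤ w := by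
    rw [← Real.log_le_log_iff hr0 hw0, hr, Real.log_pow]; exact hfl
  have hwr : w ≤ r * η := by
    rw [← Real.log_le_log_iff hw0 (by positivity), hr, ← pow_succ, Real.log_pow]
    push_cast; exact hfl2.le
  have hll : ℓ ≤ η ^ 2 * log (log w) := by
    refine h3.trans ?_
    gcongr
  have hlam0 : 0 < lam := Real.sqrt_pos.2 (by positivity)
  have hlam2 : lam ^ 2 = 2 * ℓ / r := Real.sq_sqrt (by positivity)
  have hllw : 0 < log (log w) := Real.log_pos (by linarith)
  refine ⟨?_, by positivity⟩
  have hη0 : 0 < η := by linarith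
  have hden : 1 / η < 1 - lam * B := by linarith
  have hz : z t ≤ η * (lam * w / 2) + ℓ / lam := by
    have e1 : lam ^ 2 / (2 * (1 - lam * B)) * w ≤ lam ^ 2 / (2 * (1 / η)) * w := by
      gcongr
    have e2 : lam * z t ≤ lam * (η * (lam * w / 2) + ℓ / lam) := by
      have : lam * (η * (lam * w / 2) + ℓ / lam) = lam ^ 2 / (2 * (1 / η)) * w + ℓ := by
        field_simp
      have h1' := h1 t
      change lam * z t ≤ lam ^ 2 / (2 * (1 - lam * B)) * w + ℓ at h1'
      linarith
    exact le_of_mul_le_mul_left e2 hlam0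
  set S := √(2 * ℓ * w) with hS
  have hSS : S ^ 2 = 2 * ℓ * w := Real.sq_sqrt (by positivity)
  have hS0 : 0 ≤ S := Real.sqrt_nonneg _
  have b1 : lam * w / 2 ≤ η * S / 2 := by
    have : lam * w ≤ η * S := by
      refine abs_le_of_sq_le_sq' ?_ (by positivity) |>.2
      rw [mul_pow, mul_pow, hlam2, hSS]
      rw [div_mul_eq_mul_div, div_le_iff₀ hr0]
      have : w * w ≤ w * (r * η) := by gcongr
      have : r * η * w ≤ η ^2 * r * w := by
        have : η ≤ η ^ 2 := by nlinarith
        nlinarith [mul_pos hr0 hw0]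
      have : w ^ 2 ≤ η ^ 2 * w * r := by nlinarith
      nlinarith
    linarith
  have b2 : ℓ / lam ≤ S / 2 := by
    have : 2 * (ℓ / lam) ≤ S := by
      refine abs_le_of_sq_le_sq' ?_ hS0 |>.2
      rw [mul_pow, div_pow, hlam2, hSS]
      have : (2:ℝ) ^ 2 * (ℓ ^ 2 / (2 * ℓ / r)) = 2 * ℓ * r := by field_simp
      rw [this]; gcongr
    linarith
  have b3 : S ≤ η * √(2 * w * log (log w)) := by
    rw [hS]
    refine Real.sqrt_le_iff.2 ⟨by positivity, ?_⟩
    rw [mul_pow, Real.sq_sqrt (by positivity)]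
    nlinarith
  have b4 : z t ≤ η ^ 2 * S := by
    have : η * (lam * w / 2) ≤ η * (η * S / 2) := by gcongr
    have h1η : 1 ≤ η ^ 2 := by nlinarith
    have : S ≤ η ^ 2 * S := le_mul_of_one_le_left hS0 h1η
    have : η * (η * S / 2) = η ^ 2 * S / 2 := by ring
    linarith
  calc z t ≤ η ^ 2 * S := b4
    _ ≤ η ^ 2 * (η * √(2 * w * log (log w))) := by gcongr
    _ = _ := by ring

lemma hasSum_phi (x : ℝ) : HasSum (fun j : ℕ => x ^ (j + 2) / ((j + 2).factorial : ℝ)) (exp x - 1 - x) := by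
  have h := NormedSpace.expSeries_div_hasSum_exp x
  rw [← Real.exp_eq_exp_ℝ] at h
  have h2 := (hasSum_nat_add_iff' 2).2 h
  simpa [Finset.sum_range_succ, sub_sub] using h2

lemma phi_nonneg (x : ℝ) : 0 ≤ exp x - 1 - x := by
  have := Real.add_one_le_exp x
  linarith

section
variable {Ω : Type*} {m m0 : MeasurableSpace Ω} {μ : Measure Ω} [IsProbabilityMeasure μ]

lemma bern_lintegral (hm : m ≤ m0) {ε σ c g : Ω → ℝ} {B lam N : ℝ} (hB : 0 < B)
    (hlam : 0 ≤ lam) (hlB : lam * B < 1)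
    (hε : Integrable ε μ)
    (hmom : ∀ k, Integrable (fun ω => |ε ω| ^ k) μ)
    (hbern : ∀ k : ℕ, 2 ≤ k → μ[fun ω => |ε ω| ^ k | m] ≤ᵐ[μ]
        fun ω => (1 / 2) * (Nat.factorial k : ℝ) * B ^ (k - 2) * σ ω ^ 2)
    (hσ : StronglyMeasurable[m] σ) (hc : StronglyMeasurable[m] c) (hg : StronglyMeasurable[m] g)
    (hc0 : ∀ ω, 0 ≤ c ω) (hcN : ∀ ω, c ω ≤ N) (hg0 : ∀ ω, 0 ≤ g ω) (hg1 : ∀ ω, g ω ≤ 1)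
    (hcσ : ∀ ω, c ω * σ ω ^ 2 ≤ N) :
    ∫⁻ ω, ENNReal.ofReal (c ω * (exp (lam * g ω * |ε ω|) - 1 - lam * g ω * |ε ω|)) ∂μ ≤
      ENNReal.ofReal (∫ ω, c ω * (lam ^ 2 / (2 * (1 - lam * B)) * (g ω ^ 2 * σ ω ^ 2)) ∂μ) := by
  have hi1 : ∀ k, Integrable (fun ω => (c ω * g ω ^ k) * |ε ω| ^ k) μ := fun k => by
    refine (hmom k).bdd_mul (c := N) ((hc.mul (hg.pow k)).mono hm).aestronglyMeasurable ?_
    refine Eventually.of_forall fun ω => ?_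
    rw [Real.norm_of_nonneg (mul_nonneg (hc0 ω) (pow_nonneg (hg0 ω) k))]
    calc c ω * g ω ^ k ≤ c ω * 1 := by
          gcongr
          · exact hc0 ω
          · exact pow_le_one₀ (hg0 ω) (hg1 ω)
      _ ≤ N := by simpa using hcN ω
  have hi2 : ∀ k, Integrable (fun ω => c ω * g ω ^ k * σ ω ^ 2) μ := fun k => by
    refine Integrable.of_bound (C := N)
      (((hc.mul (hg.pow k)).mul (hσ.pow 2)).mono hm).aestronglyMeasurable ?_
    refine Eventually.of_forall fun ω => ?_
    have h0 := hc0 ω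
    have h1 := hg0 ω
    rw [Real.norm_of_nonneg (by positivity)]
    calc c ω * g ω ^ k * σ ω ^ 2 ≤ c ω * 1 * σ ω ^ 2 := by
          gcongr
          exact pow_le_one₀ (hg0 ω) (hg1 ω)
      _ ≤ N := by simpa using hcσ ω
  set I := ∫ ω, c ω * g ω ^ 2 * σ ω ^ 2 ∂μ with hI
  have hI0 : 0 ≤ I := integral_nonneg fun ω => by
    have h0 := hc0 ω
    positivity
  have key : ∀ j : ℕ, ∫ ω, (c ω * g ω ^ (j + 2)) * |ε ω| ^ (j + 2) ∂μ ≤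
      (1 / 2) * (Nat.factorial (j + 2) : ℝ) * B ^ j * I := by
    intro j
    have e1 : μ[(fun ω => c ω * g ω ^ (j + 2)) * (fun ω => |ε ω| ^ (j + 2)) | m] =ᵐ[μ]
        (fun ω => c ω * g ω ^ (j + 2)) * μ[fun ω => |ε ω| ^ (j + 2) | m] := by
      exact condExp_mul_of_stronglyMeasurable_left (hc.mul (hg.pow _)) (hi1 (j + 2)) (hmom _)
    have e2 : ∫ ω, (c ω * g ω ^ (j + 2)) * |ε ω| ^ (j + 2) ∂μ =
        ∫ ω, ((fun ω => c ω * g ω ^ (j + 2)) * μ[fun ω => |ε ω| ^ (j + 2) | m]) ω ∂μ := by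
      rw [← integral_congr_ae e1, integral_condExp hm]
      rfl
    rw [e2, hI, ← integral_const_mul]
    refine integral_mono_ae ((integrable_condExp (m := m)).congr e1) ((hi2 2).const_mul _) ?_
    filter_upwards [hbern (j + 2) (by omega)] with ω hω
    simp only [Pi.mul_apply]
    simp only [Nat.add_sub_cancel] at hω
    have h0 := hc0 ω
    have h1 := hg0 ω
    calc c ω * g ω ^ (j + 2) * (μ[fun ω => |ε ω| ^ (j + 2) | m]) ω
        ≤ c ω * g ω ^ (j + 2) * ((1 / 2) * (Nat.factorial (j+2) : ℝ) * B ^ j * σ ω ^ 2) := by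
          gcongr
      _ ≤ c ω * g ω ^ 2 * ((1 / 2) * (Nat.factorial (j+2) : ℝ) * B ^ j * σ ω ^ 2) := by
          have : g ω ^ (j + 2) ≤ g ω ^ 2 := pow_le_pow_of_le_one h1 (hg1 ω) (by omega)
          gcongr
      _ = _ := by ring
  have hcm : AEMeasurable c μ := (hc.mono hm).measurable.aemeasurable
  have hgm : AEMeasurable g μ := (hg.mono hm).measurable.aemeasurable
  have hεm : AEMeasurable ε μ := hε.aemeasurable
  calc ∫⁻ ω, ENNReal.ofReal (c ω * (exp (lam * g ω * |ε ω|) - 1 - lam * g ω * |ε ω|)) ∂μ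
      = ∫⁻ ω, ∑' j : ℕ, ENNReal.ofReal
          (c ω * ((lam * g ω * |ε ω|) ^ (j + 2) / ((j + 2).factorial : ℝ))) ∂μ := by
        refine lintegral_congr fun ω => ?_
        have hs := (hasSum_phi (lam * g ω * |ε ω|)).mul_left (c ω)
        rw [← hs.tsum_eq, ENNReal.ofReal_tsum_of_nonneg _ hs.summable]
        intro j
        have h0 := hc0 ω
        have h1 := hg0 ω
        positivity
    _ = ∑' j : ℕ, ∫⁻ ω, ENNReal.ofReal
          (c ω * ((lam * g ω * |ε ω|) ^ (j + 2) / ((j + 2).factorial : ℝ))) ∂μ := by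
        refine lintegral_tsum fun j => ?_
        have : AEMeasurable (fun ω => |ε ω|) μ := hεm.abs
        fun_prop
    _ ≤ ∑' j : ℕ, ENNReal.ofReal ((lam * B) ^ j * (lam ^ 2 / 2 * I)) := by
        refine ENNReal.tsum_le_tsum fun j => ?_
        have e : (fun ω => c ω * ((lam * g ω * |ε ω|) ^ (j + 2) / ((j + 2).factorial : ℝ))) =
            fun ω => lam ^ (j + 2) / ((j + 2).factorial : ℝ) *
              ((c ω * g ω ^ (j + 2)) * |ε ω| ^ (j + 2)) := by
          funext ω
          rw [mul_pow, mul_pow]; ring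
        have hint : Integrable (fun ω => c ω * ((lam * g ω * |ε ω|) ^ (j + 2) /
            ((j + 2).factorial : ℝ))) μ := by
          rw [e]; exact (hi1 (j + 2)).const_mul _
        rw [← ofReal_integral_eq_lintegral_ofReal hint]
        · refine ENNReal.ofReal_le_ofReal ?_
          rw [e, integral_const_mul]
          calc lam ^ (j + 2) / ((j + 2).factorial : ℝ) *
              ∫ ω, ((c ω * g ω ^ (j + 2)) * |ε ω| ^ (j + 2)) ∂μ
              ≤ lam ^ (j + 2) / ((j + 2).factorial : ℝ) *
                ((1 / 2) * (Nat.factorial (j + 2) : ℝ) * B ^ j * I) := by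
                gcongr
                exact key j
            _ = _ := by
                have : ((j + 2).factorial : ℝ) ≠ 0 := by positivity
                field_simp
                ring
        · refine Eventually.of_forall fun ω => ?_
          have h0 := hc0 ω
          have h1 := hg0 ω
          simp only [Pi.zero_apply]
          positivity
    _ = ENNReal.ofReal (∑' j : ℕ, (lam * B) ^ j * (lam ^ 2 / 2 * I)) := by
        rw [ENNReal.ofReal_tsum_of_nonneg]
        · intro j; positivity
        · exact (summable_geometric_of_lt_one (by positivity) hlB).mul_right _
    _ = _ := by
        congr 1
        rw [tsum_mul_right, tsum_geometric_of_lt_one (by positivity) hlB, hI, ← mul_assoc,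
          ← integral_const_mul]
        have : (1 - lam * B) ≠ 0 := by linarith
        congr 1
        funext ω
        field_simp

lemma step0 (hm : m ≤ m0) {ε σ c g h Y : Ω → ℝ} {B lam N : ℝ} (hB : 0 < B)
    (hlam : 0 ≤ lam) (hlB : lam * B < 1)
    (hε : Integrable ε μ) (hε0 : μ[ε | m] =ᵐ[μ] 0)
    (hmom : ∀ k, Integrable (fun ω => |ε ω| ^ k) μ)
    (hbern : ∀ k : ℕ, 2 ≤ k → μ[fun ω => |ε ω| ^ k | m] ≤ᵐ[μ]
        fun ω => (1 / 2) * (Nat.factorial k : ℝ) * B ^ (k - 2) * σ ω ^ 2)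
    (hσ : StronglyMeasurable[m] σ) (hc : StronglyMeasurable[m] c) (hg : StronglyMeasurable[m] g)
    (hh : StronglyMeasurable[m] h)
    (hc0 : ∀ ω, 0 ≤ c ω) (hcN : ∀ ω, c ω ≤ N) (hg0 : ∀ ω, 0 ≤ g ω) (hg1 : ∀ ω, g ω ≤ 1)
    (hcσ : ∀ ω, c ω * σ ω ^ 2 ≤ N) (hhN : ∀ ω, |h ω| ≤ N)
    (hY0 : ∀ ω, 0 ≤ Y ω)
    (hY : ∀ ω, Y ω ≤ c ω + h ω * ε ω +
      c ω * (exp (lam * g ω * |ε ω|) - 1 - lam * g ω * |ε ω|)) :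
    ∫⁻ ω, ENNReal.ofReal (Y ω) ∂μ ≤ ∫⁻ ω, ENNReal.ofReal
      (c ω * (1 + lam ^ 2 / (2 * (1 - lam * B)) * (g ω ^ 2 * σ ω ^ 2))) ∂μ := by
  have hb := bern_lintegral hm hB hlam hlB hε hmom hbern hσ hc hg hc0 hcN hg0 hg1 hcσ
  have hcm : AEMeasurable c μ := (hc.mono hm).measurable.aemeasurable
  have hgm : AEMeasurable g μ := (hg.mono hm).measurable.aemeasurable
  have hεm : AEMeasurable ε μ := hε.aemeasurable
  have hεm' : AEMeasurable (fun ω => |ε ω|) μ := hεm.abs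
  have hci : Integrable c μ := Integrable.of_bound (C := N) hcm.aestronglyMeasurable
    (Eventually.of_forall fun ω => by rw [Real.norm_of_nonneg (hc0 ω)]; exact hcN ω)
  have hhi : Integrable (fun ω => h ω * ε ω) μ :=
    hε.bdd_mul (c := N) (hh.mono hm).aestronglyMeasurable (Eventually.of_forall hhN)
  have hh0 : ∫ ω, h ω * ε ω ∂μ = 0 := by
    have e1 : μ[h * ε | m] =ᵐ[μ] h * μ[ε | m] :=
      condExp_mul_of_stronglyMeasurable_left hh hhi hε
    have e2 : ∫ ω, (h * ε) ω ∂μ = ∫ ω, (h * μ[ε | m]) ω ∂μ := by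
      rw [← integral_congr_ae e1, integral_condExp hm]
    change ∫ ω, (h * ε) ω ∂μ = 0
    rw [e2]
    refine integral_eq_zero_of_ae ?_
    filter_upwards [hε0] with ω hω
    simp [hω]
  set F := fun ω => c ω * (exp (lam * g ω * |ε ω|) - 1 - lam * g ω * |ε ω|) with hF
  have hF0 : ∀ ω, 0 ≤ F ω := fun ω => mul_nonneg (hc0 ω) (phi_nonneg _)
  have hFm : AEStronglyMeasurable F μ := by
    have : AEMeasurable F μ := by fun_prop
    exact this.aestronglyMeasurable
  have hFi : Integrable F μ := by
    refine ⟨hFm, ?_⟩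
    rw [hasFiniteIntegral_iff_ofReal (Eventually.of_forall hF0)]
    exact hb.trans_lt ENNReal.ofReal_lt_top
  have hGi : Integrable (fun ω => c ω * (lam ^ 2 / (2 * (1 - lam * B)) * (g ω ^ 2 * σ ω ^ 2))) μ := by
    have : Integrable (fun ω => c ω * g ω ^ 2 * σ ω ^ 2) μ := by
      refine Integrable.of_bound (C := N)
        (((hc.mul (hg.pow 2)).mul (hσ.pow 2)).mono hm).aestronglyMeasurable ?_
      refine Eventually.of_forall fun ω => ?_
      have h0 := hc0 ω
      have h1 := hg0 ω
      rw [Real.norm_of_nonneg (by positivity)]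
      calc c ω * g ω ^ 2 * σ ω ^ 2 ≤ c ω * 1 * σ ω ^ 2 := by
            gcongr
            exact pow_le_one₀ (hg0 ω) (hg1 ω)
        _ ≤ N := by simpa using hcσ ω
    refine (this.const_mul (lam ^ 2 / (2 * (1 - lam * B)))).congr (Eventually.of_forall fun ω => ?_)
    simp only; ring
  have hden : 0 < 1 - lam * B := by linarith
  have hFle : ∫ ω, F ω ∂μ ≤
      ∫ ω, c ω * (lam ^ 2 / (2 * (1 - lam * B)) * (g ω ^ 2 * σ ω ^ 2)) ∂μ := by
    rw [← ofReal_integral_eq_lintegral_ofReal hFi (Eventually.of_forall hF0)] at hb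
    refine (ENNReal.ofReal_le_ofReal_iff (integral_nonneg fun ω => ?_)).1 hb
    have h0 := hc0 ω
    simp only [Pi.zero_apply]
    positivity
  calc ∫⁻ ω, ENNReal.ofReal (Y ω) ∂μ ≤ ∫⁻ ω, ENNReal.ofReal (c ω + h ω * ε ω + F ω) ∂μ :=
        lintegral_mono fun ω => ENNReal.ofReal_le_ofReal (hY ω)
    _ = ENNReal.ofReal (∫ ω, c ω + h ω * ε ω + F ω ∂μ) := by
        refine (ofReal_integral_eq_lintegral_ofReal ((hci.add hhi).add hFi) ?_).symm
        exact Eventually.of_forall fun ω => (hY0 ω).trans (hY ω)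
    _ ≤ ENNReal.ofReal (∫ ω, c ω +
          c ω * (lam ^ 2 / (2 * (1 - lam * B)) * (g ω ^ 2 * σ ω ^ 2)) ∂μ) := by
        refine ENNReal.ofReal_le_ofReal ?_
        rw [integral_add (f := fun ω => c ω + h ω * ε ω) (hci.add hhi) hFi, integral_add hci hhi,
          hh0, integral_add hci hGi]
        linarith
    _ = ∫⁻ ω, ENNReal.ofReal (c ω +
          c ω * (lam ^ 2 / (2 * (1 - lam * B)) * (g ω ^ 2 * σ ω ^ 2))) ∂μ := by
        refine ofReal_integral_eq_lintegral_ofReal (hci.add hGi) ?_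
        refine Eventually.of_forall fun ω => ?_
        have h0 := hc0 ω
        simp only [Pi.zero_apply]
        positivity
    _ = _ := by
        refine lintegral_congr fun ω => ?_
        rw [mul_add, mul_one]

lemma step1 (hm : m ≤ m0) {ε σ c g h Y : Ω → ℝ} {B lam : ℝ} (hB : 0 < B)
    (hlam : 0 ≤ lam) (hlB : lam * B < 1)
    (hε : Integrable ε μ) (hε0 : μ[ε | m] =ᵐ[μ] 0)
    (hmom : ∀ k, Integrable (fun ω => |ε ω| ^ k) μ)
    (hbern : ∀ k : ℕ, 2 ≤ k → μ[fun ω => |ε ω| ^ k | m] ≤ᵐ[μ]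
        fun ω => (1 / 2) * (Nat.factorial k : ℝ) * B ^ (k - 2) * σ ω ^ 2)
    (hσ : StronglyMeasurable[m] σ) (hc : StronglyMeasurable[m] c) (hg : StronglyMeasurable[m] g)
    (hh : StronglyMeasurable[m] h)
    (hc0 : ∀ ω, 0 ≤ c ω) (hg0 : ∀ ω, 0 ≤ g ω) (hg1 : ∀ ω, g ω ≤ 1)
    (hY0 : ∀ ω, 0 ≤ Y ω)
    (hY : ∀ ω, Y ω ≤ c ω + h ω * ε ω +
      c ω * (exp (lam * g ω * |ε ω|) - 1 - lam * g ω * |ε ω|))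
    {A : Set Ω} (hA : MeasurableSet[m] A) :
    ∫⁻ ω in A, ENNReal.ofReal (Y ω) ∂μ ≤ ∫⁻ ω in A, ENNReal.ofReal
      (c ω * (1 + lam ^ 2 / (2 * (1 - lam * B)) * (g ω ^ 2 * σ ω ^ 2))) ∂μ := by
  set R : Ω → ℝ := fun ω => c ω + c ω * σ ω ^ 2 + |h ω| with hR
  have hRm : Measurable[m] R :=
    (hc.measurable.add (hc.measurable.mul (hσ.measurable.pow_const 2))).add
      ((measurable_norm (α := ℝ)).comp hh.measurable)
  set S : ℕ → Set Ω := fun n => A ∩ {ω | R ω ≤ n} with hS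
  have hSm : ∀ n, MeasurableSet[m] (S n) := fun n =>
    MeasurableSet.inter hA (hRm measurableSet_Iic)
  have hSU : ⋃ n, S n = A := by
    ext ω
    simp only [hS, Set.mem_iUnion, Set.mem_inter_iff, Set.mem_ofPred_eq, exists_and_left,
      and_iff_left_iff_imp]
    intro _
    exact exists_nat_ge _
  have hdir : Directed (· ⊆ ·) S := by
    refine (monotone_nat_of_le_succ fun n => ?_).directed_le
    rintro ω ⟨h1, h2⟩
    refine ⟨h1, ?_⟩
    have h2' : R ω ≤ n := h2
    change R ω ≤ ((n + 1 : ℕ) : ℝ)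
    push_cast; linarith
  rw [← hSU, setLIntegral_iUnion_of_directed _ hdir, setLIntegral_iUnion_of_directed _ hdir]
  refine iSup_mono fun n => ?_
  have h0 := step0 (μ := μ) (N := (n:ℝ)) (c := (S n).indicator c) (h := (S n).indicator h)
    (Y := (S n).indicator Y) hm hB hlam hlB hε hε0 hmom hbern hσ (hc.indicator (hSm n)) hg
    (hh.indicator (hSm n)) (fun ω => Set.indicator_nonneg (fun ω _ => hc0 ω) ω) ?_ hg0 hg1 ?_ ?_
    (fun ω => Set.indicator_nonneg (fun ω _ => hY0 ω) ω) ?_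
  · rw [← lintegral_indicator (hm _ (hSm n)), ← lintegral_indicator (hm _ (hSm n))]
    refine le_trans (le_of_eq ?_) (h0.trans (le_of_eq ?_))
    · refine lintegral_congr fun ω => ?_
      by_cases hω : ω ∈ S n <;> simp [hω]
    · refine lintegral_congr fun ω => ?_
      by_cases hω : ω ∈ S n <;> simp [hω]
  all_goals
    intro ω
    by_cases hω : ω ∈ S n
    · have hle : c ω + c ω * σ ω ^ 2 + |h ω| ≤ n := hω.2
      have hc := hc0 ω
      have h1 : 0 ≤ c ω * σ ω ^ 2 := by positivity
      have h2 := abs_nonneg (h ω)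
      have h3 := hY ω
      simp only [Set.indicator_of_mem hω]
      linarith
    · simp [hω]

end

lemma ville {Ω : Type*} {m0 : MeasurableSpace Ω} {μ : Measure Ω} [IsProbabilityMeasure μ]
    (ℱ : Filtration ℕ m0) (L : ℕ → Ω → ℝ)
    (hLm : ∀ t, StronglyMeasurable[ℱ t] (L t)) (h0 : ∀ ω, L 0 ω = 1)
    (hstep : ∀ t (A : Set Ω), MeasurableSet[ℱ t] A →
      ∫⁻ ω in A, ENNReal.ofReal (L (t + 1) ω) ∂μ ≤ ∫⁻ ω in A, ENNReal.ofReal (L t ω) ∂μ)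
    {a : ℝ} (ha : 0 < a) : μ {ω | ∃ t, a ≤ L t ω} ≤ ENNReal.ofReal (1 / a) := by
  set U : ℕ → Set Ω := fun n => {ω | ∃ s ≤ n, a ≤ L s ω} with hU
  have hge : ∀ t, MeasurableSet[ℱ t] {ω | a ≤ L t ω} := fun t =>
    (hLm t).measurable measurableSet_Ici
  have hUsucc : ∀ n, U (n + 1) = U n ∪ {ω | a ≤ L (n + 1) ω} := by
    intro n; ext ω
    simp only [hU, Set.mem_ofPred_eq, Set.mem_union]
    constructor
    · rintro ⟨s, hs, h⟩
      rcases Nat.lt_or_ge n s with h1 | h1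
      · right
        have : s = n + 1 := by omega
        rwa [this] at h
      · exact Or.inl ⟨s, h1, h⟩
    · rintro (⟨s, hs, h⟩ | h)
      · exact ⟨s, by omega, h⟩
      · exact ⟨n + 1, le_rfl, h⟩
  have hUm : ∀ n, MeasurableSet[ℱ n] (U n) := by
    intro n
    induction n with
    | zero =>
      have : U 0 = {ω | a ≤ L 0 ω} := by ext ω; simp [hU]
      rw [this]; exact hge 0
    | succ n ih =>
      rw [hUsucc]
      exact MeasurableSet.union (ℱ.mono (Nat.le_succ n) _ ih) (hge _)
  have key : ∀ n, ENNReal.ofReal a * μ (U n) + ∫⁻ ω in (U n)ᶜ, ENNReal.ofReal (L n ω) ∂μ ≤ 1 := by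
    intro n
    have cheb : ∀ (t : ℕ) (S : Set Ω), MeasurableSet S →
        ENNReal.ofReal a * μ (S ∩ {ω | a ≤ L t ω}) ≤
          ∫⁻ ω in S ∩ {ω | a ≤ L t ω}, ENNReal.ofReal (L t ω) ∂μ := by
      intro t S hS
      rw [← setLIntegral_const]
      refine setLIntegral_mono' (hS.inter (ℱ.le t _ (hge t))) fun ω hω => ?_
      exact ENNReal.ofReal_le_ofReal hω.2
    induction n with
    | zero =>
      have e : U 0 = Set.univ ∩ {ω | a ≤ L 0 ω} := by ext ω; simp [hU]
      calc _ ≤ ∫⁻ ω in U 0, ENNReal.ofReal (L 0 ω) ∂μ +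
            ∫⁻ ω in (U 0)ᶜ, ENNReal.ofReal (L 0 ω) ∂μ := by
            gcongr
            rw [e]; exact cheb 0 _ MeasurableSet.univ
        _ = ∫⁻ ω, ENNReal.ofReal (L 0 ω) ∂μ := lintegral_add_compl _ (ℱ.le 0 _ (hUm 0))
        _ = 1 := by simp [h0]
    | succ n ih =>
      have hUn := ℱ.le n _ (hUm n)
      have e1 : U (n + 1) = U n ∪ ((U n)ᶜ ∩ {ω | a ≤ L (n + 1) ω}) := by
        rw [hUsucc]; ext ω; simp only [Set.mem_union, Set.mem_inter_iff, Set.mem_compl_iff]; tauto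
      have e2 : (U (n + 1))ᶜ = (U n)ᶜ \ {ω | a ≤ L (n + 1) ω} := by
        rw [hUsucc]; ext ω; simp
      calc ENNReal.ofReal a * μ (U (n + 1)) +
            ∫⁻ ω in (U (n + 1))ᶜ, ENNReal.ofReal (L (n + 1) ω) ∂μ
          ≤ ENNReal.ofReal a * (μ (U n) + μ ((U n)ᶜ ∩ {ω | a ≤ L (n + 1) ω})) +
            ∫⁻ ω in (U n)ᶜ \ {ω | a ≤ L (n + 1) ω}, ENNReal.ofReal (L (n + 1) ω) ∂μ := by
            rw [e2]
            gcongr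
            rw [e1]; exact measure_union_le _ _
        _ ≤ ENNReal.ofReal a * μ (U n) +
            (∫⁻ ω in (U n)ᶜ ∩ {ω | a ≤ L (n + 1) ω}, ENNReal.ofReal (L (n + 1) ω) ∂μ +
            ∫⁻ ω in (U n)ᶜ \ {ω | a ≤ L (n + 1) ω}, ENNReal.ofReal (L (n + 1) ω) ∂μ) := by
            rw [mul_add, add_assoc]
            gcongr
            exact cheb _ _ hUn.compl
        _ = ENNReal.ofReal a * μ (U n) +
            ∫⁻ ω in (U n)ᶜ, ENNReal.ofReal (L (n + 1) ω) ∂μ := by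
            rw [lintegral_inter_add_sdiff _ _ (ℱ.le _ _ (hge (n + 1)))]
        _ ≤ ENNReal.ofReal a * μ (U n) + ∫⁻ ω in (U n)ᶜ, ENNReal.ofReal (L n ω) ∂μ := by
            refine add_le_add le_rfl ?_
            exact hstep n _ (MeasurableSet.compl (hUm n))
        _ ≤ 1 := ih
  have hun : {ω | ∃ t, a ≤ L t ω} = ⋃ n, U n := by
    ext ω
    simp only [hU, Set.mem_ofPred_eq, Set.mem_iUnion]
    exact ⟨fun ⟨t, h⟩ => ⟨t, t, le_rfl, h⟩, fun ⟨_, s, _, h⟩ => ⟨s, h⟩⟩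
  have hmono : Monotone U := fun i j hij ω ⟨s, hs, h⟩ => ⟨s, hs.trans hij, h⟩
  rw [hun, hmono.measure_iUnion]
  refine iSup_le fun n => ?_
  have h1 : ENNReal.ofReal a * μ (U n) ≤ 1 := le_trans le_self_add (key n)
  rw [one_div, ENNReal.ofReal_inv_of_pos ha]
  rw [ENNReal.le_inv_iff_mul_le, mul_comm]; exact h1

set_option linter.unusedSectionVars false

section
variable {H : Type*} [NormedAddCommGroup H] [InnerProductSpace ℝ H] [CompleteSpace H]

lemma outerProd_apply (x y : H) : outerProd x y = ⟪x, y⟫ • x := by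
  simp [outerProd]

lemma outerProd_continuous : Continuous (outerProd : H → H →L[ℝ] H) := by
  unfold outerProd
  fun_prop

lemma stronglyMeasurable_inverse {Ω : Type*} {m : MeasurableSpace Ω} {A : Ω → H →L[ℝ] H}
    (hA : StronglyMeasurable A) (hu : ∀ ω, IsUnit (A ω)) :
    StronglyMeasurable (fun ω => Ring.inverse (A ω)) := by
  refine ⟨fun n => (hA.approx n).map Ring.inverse, fun ω => ?_⟩
  obtain ⟨u, hu⟩ := hu ω
  have := NormedRing.inverse_continuousAt u
  rw [hu] at this
  exact this.tendsto.comp (hA.tendsto_approx ω)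

variable {A Q R : H →L[ℝ] H}

lemma inv_eq (hsq : Q ∘L Q = A) (hinv : R ∘L Q = 1 ∧ Q ∘L R = 1) :
    IsUnit A ∧ Ring.inverse A = R * R := by
  have h1 : R * Q = 1 := hinv.1
  have h2 : Q * R = 1 := hinv.2
  have h3 : Q * Q = A := hsq
  let u : (H →L[ℝ] H)ˣ := ⟨A, R * R, by
    rw [← h3, mul_assoc, ← mul_assoc Q R, h2, one_mul, h2], by
    rw [← h3, mul_assoc, ← mul_assoc R Q, h1, one_mul, h1]⟩
  exact ⟨⟨u, rfl⟩, Ring.inverse_unit u⟩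

lemma inv_symm (hpos : Q.IsPositive) (hinv : R ∘L Q = 1 ∧ Q ∘L R = 1) (x y : H) :
    ⟪R x, y⟫ = ⟪x, R y⟫ := by
  have h2 : ∀ z, Q (R z) = z := fun z => by
    have := congrArg (fun T : H →L[ℝ] H => T z) hinv.2
    simpa using this
  have := hpos.isSymmetric (R x) (R y)
  simp only [ContinuousLinearMap.coe_coe, h2] at this
  exact this.symm

lemma inner_inv (hpos : Q.IsPositive) (hsq : Q ∘L Q = A) (hinv : R ∘L Q = 1 ∧ Q ∘L R = 1)
    (x y : H) : ⟪R x, R y⟫ = ⟪Ring.inverse A x, y⟫ := by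
  rw [(inv_eq hsq hinv).2, ← inv_symm hpos hinv]
  rfl

lemma inner_sq (hpos : Q.IsPositive) (hsq : Q ∘L Q = A) (x : H) : ‖Q x‖ ^ 2 = ⟪x, A x⟫ := by
  rw [← hsq, ← real_inner_self_eq_norm_sq]
  exact hpos.isSymmetric x (Q x)

lemma norm_G_le {A' : H →L[ℝ] H} {x : H} (hpos : Q.IsPositive) (hsq : Q ∘L Q = A' + outerProd x)
    (hA' : ∀ y, 0 ≤ ⟪y, A' y⟫)
    (hinv : R ∘L Q = 1 ∧ Q ∘L R = 1) : ‖R x‖ ≤ 1 := by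
  have h2 : ∀ z, Q (R z) = z := fun z => by
    have := congrArg (fun T : H →L[ℝ] H => T z) hinv.2
    simpa using this
  have h := inner_sq hpos hsq (R (R x))
  rw [h2, _root_.add_apply, inner_add_right, outerProd_apply, inner_smul_right,
    real_inner_comm (R (R x)) x, inv_symm hpos hinv (R x) x, real_inner_self_eq_norm_sq] at h
  have h3 := hA' (R (R x))
  have h4 := norm_nonneg (R x)
  by_contra hc
  push Not at hc
  nlinarith [sq_nonneg (‖R x‖), mul_pos (sub_pos.2 hc) (sub_pos.2 hc)]

lemma norm_inv_mono {A' Q' R' : H →L[ℝ] H} {x : H} (M : H) (hpos : Q.IsPositive)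
    (hsq : Q ∘L Q = A' + outerProd x)
    (hpos' : Q'.IsPositive) (hsq' : Q' ∘L Q' = A')
    (hinv : R ∘L Q = 1 ∧ Q ∘L R = 1) (hinv' : R' ∘L Q' = 1 ∧ Q' ∘L R' = 1) :
    ‖R M‖ ≤ ‖R' M‖ := by
  have h2 : ∀ z, Q (R z) = z := fun z => by
    have := congrArg (fun T : H →L[ℝ] H => T z) hinv.2
    simpa using this
  have h2' : ∀ z, Q' (R' z) = z := fun z => by
    have := congrArg (fun T : H →L[ℝ] H => T z) hinv'.2
    simpa using this
  set y := R (R M) with hy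
  have e1 : ‖R M‖ ^ 2 = ⟪Q' y, R' M⟫ := by
    rw [← real_inner_self_eq_norm_sq, ← inv_symm hpos hinv, ← hy]
    have := hpos'.isSymmetric y (R' M)
    simp only [ContinuousLinearMap.coe_coe, h2'] at this
    exact this.symm
  have h := inner_sq hpos hsq y
  have h' := inner_sq hpos' hsq' y
  rw [hy, h2, ← hy, _root_.add_apply, inner_add_right, outerProd_apply,
    inner_smul_right, real_inner_comm y x, ← h'] at h
  have e3 : ‖Q' y‖ ≤ ‖R M‖ := by
    refine abs_le_of_sq_le_sq' ?_ (norm_nonneg _) |>.2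
    nlinarith [mul_self_nonneg ⟪y, x⟫]
  have e4 : ‖R M‖ ^ 2 ≤ ‖R M‖ * ‖R' M‖ := by
    rw [e1]
    exact (real_inner_le_norm _ _).trans (by gcongr)
  rcases (norm_nonneg (R M)).eq_or_lt with h0 | h0
  · rw [← h0]; exact norm_nonneg _
  · nlinarith

end

section
variable {H : Type*} [NormedAddCommGroup H] [InnerProductSpace ℝ H] [CompleteSpace H]

lemma sm_inner_apply {Ω : Type*} {m : MeasurableSpace Ω} {P : Ω → H →L[ℝ] H} {x y : Ω → H}
    (hP : StronglyMeasurable P) (hx : StronglyMeasurable x) (hy : StronglyMeasurable y) :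
    StronglyMeasurable (fun ω => ⟪P ω (x ω), y ω⟫) := by
  have h1 : StronglyMeasurable (fun ω => P ω (x ω)) :=
    (isBoundedBilinearMap_apply (𝕜 := ℝ) (E := H) (F := H)).continuous.comp_stronglyMeasurable
      (hP.prodMk hx)
  exact h1.inner hy

lemma sm_norm {Ω : Type*} {m : MeasurableSpace Ω} {A Q R : Ω → H →L[ℝ] H} {x : Ω → H}
    (hA : StronglyMeasurable A) (hpos : ∀ ω, (Q ω).IsPositive) (hsq : ∀ ω, Q ω ∘L Q ω = A ω)
    (hinv : ∀ ω, R ω ∘L Q ω = 1 ∧ Q ω ∘L R ω = 1) (hx : StronglyMeasurable x) :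
    StronglyMeasurable (fun ω => ‖R ω (x ω)‖) := by
  have h1 := sm_inner_apply (stronglyMeasurable_inverse hA
    (fun ω => (inv_eq (hsq ω) (hinv ω)).1)) hx hx
  have h2 : (fun ω => ‖R ω (x ω)‖) = fun ω => √ ⟪Ring.inverse (A ω) (x ω), x ω⟫ := by
    funext ω
    rw [← inner_inv (hpos ω) (hsq ω) (hinv ω), real_inner_self_eq_norm_sq,
      Real.sqrt_sq (norm_nonneg _)]
  rw [h2]
  exact Real.continuous_sqrt.comp_stronglyMeasurable h1

lemma cosh_pinelis (u G : H) (lam e : ℝ) (hl : 0 ≤ lam) :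
    cosh (lam * ‖u + e • G‖) ≤ cosh (lam * ‖u‖) +
      (sinh (lam * ‖u‖) / (lam * ‖u‖) * (lam ^ 2 * ⟪u, G⟫)) * e +
      cosh (lam * ‖u‖) * (exp (lam * ‖G‖ * |e|) - 1 - lam * ‖G‖ * |e|) := by
  have h := cosh_norm_add (lam • u) (lam • e • G)
  rw [← smul_add] at h
  simp only [norm_smul, Real.norm_of_nonneg hl, Real.norm_eq_abs, inner_smul_left,
    inner_smul_right, conj_trivial] at h
  have e1 : lam * (|e| * ‖G‖) = lam * ‖G‖ * |e| := by ring
  rw [e1] at h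
  have e2 : sinh (lam * ‖u‖) / (lam * ‖u‖) * (lam * (lam * (e * ⟪u, G⟫))) =
      (sinh (lam * ‖u‖) / (lam * ‖u‖) * (lam ^ 2 * ⟪u, G⟫)) * e := by ring
  linarith [h, e2]

lemma ville_Z
    {Ω : Type*} {m0 : MeasurableSpace Ω} {μ : Measure Ω} [IsProbabilityMeasure μ]
    (ℱ : Filtration ℕ m0)
    (X : ℕ → Ω → H) (ε : ℕ → Ω → ℝ)
    (hX : ∀ t, 1 ≤ t → StronglyMeasurable[ℱ (t - 1)] (X t))
    (hεmeas : ∀ t, 1 ≤ t → StronglyMeasurable[ℱ t] (ε t))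
    (hεint : ∀ t, 1 ≤ t → Integrable (ε t) μ)
    (hε0 : ∀ t, 1 ≤ t → μ[ε t | ℱ (t - 1)] =ᵐ[μ] 0)
    (ρ : ℝ) (hρ : 0 < ρ)
    (Q Qinv : ℕ → Ω → H →L[ℝ] H)
    (hQpos : ∀ t ω, (Q t ω).IsPositive)
    (hQsq : ∀ t ω, Q t ω ∘L Q t ω =
      ρ • (1 : H →L[ℝ] H) + ∑ i ∈ Finset.Icc 1 t, outerProd (X i ω))
    (hQinv : ∀ t ω, Qinv t ω ∘L Q t ω = 1 ∧ Q t ω ∘L Qinv t ω = 1)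
    (B : ℝ) (hB : 0 < B) (σ : ℕ → Ω → ℝ)
    (hσmeas : ∀ t, 1 ≤ t → StronglyMeasurable[ℱ (t - 1)] (σ t))
    (hmom : ∀ t m, Integrable (fun ω => |ε t ω| ^ m) μ)
    (hbern : ∀ t, 1 ≤ t → ∀ m : ℕ, 2 ≤ m →
      μ[fun ω => |ε t ω| ^ m | ℱ (t - 1)] ≤ᵐ[μ]
        fun ω => (1 / 2) * (Nat.factorial m : ℝ) * B ^ (m - 2) * σ t ω ^ 2)
    (lam : ℝ) (hlam : 0 ≤ lam) (hlB : lam * B < 1) (a : ℝ) (ha : 0 < a) :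
    μ {ω | ∃ t, a ≤ exp (-(lam ^ 2 / (2 * (1 - lam * B)) *
        ∑ i ∈ Finset.Icc 1 t, ‖Qinv i ω (X i ω)‖ ^ 2 * σ i ω ^ 2)) *
      cosh (lam * ‖Qinv t ω (∑ i ∈ Finset.Icc 1 t, ε i ω • X i ω)‖)} ≤ ENNReal.ofReal (1 / a) := by
  set ψ := lam ^ 2 / (2 * (1 - lam * B)) with hψ
  have hψ0 : 0 ≤ ψ := by
    have : 0 < 1 - lam * B := by linarith
    positivity
  -- measurability
  have hAm : ∀ t s, t ≤ s + 1 → StronglyMeasurable[ℱ s]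
      (fun ω => ρ • (1 : H →L[ℝ] H) + ∑ i ∈ Finset.Icc 1 t, outerProd (X i ω)) := by
    intro t s hts
    refine stronglyMeasurable_const.add (Finset.stronglyMeasurable_fun_sum _ fun i hi => ?_)
    rw [Finset.mem_Icc] at hi
    exact outerProd_continuous.comp_stronglyMeasurable
      ((hX i hi.1).mono (ℱ.mono (by omega)))
  have hMm : ∀ t, StronglyMeasurable[ℱ t] (fun ω => ∑ i ∈ Finset.Icc 1 t, ε i ω • X i ω) := by
    intro t
    refine Finset.stronglyMeasurable_fun_sum _ fun i hi => ?_
    rw [Finset.mem_Icc] at hi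
    exact ((hεmeas i hi.1).mono (ℱ.mono hi.2)).smul ((hX i hi.1).mono (ℱ.mono (by omega)))
  have hGm : ∀ i, 1 ≤ i → StronglyMeasurable[ℱ (i - 1)] (fun ω => ‖Qinv i ω (X i ω)‖) :=
    fun i hi => sm_norm (hAm i (i - 1) (by omega)) (hQpos i) (hQsq i) (hQinv i) (hX i hi)
  have hWm : ∀ t s, t ≤ s + 1 → StronglyMeasurable[ℱ s]
      (fun ω => ∑ i ∈ Finset.Icc 1 t, ‖Qinv i ω (X i ω)‖ ^ 2 * σ i ω ^ 2) := by
    intro t s hts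
    refine Finset.stronglyMeasurable_fun_sum _ fun i hi => ?_
    rw [Finset.mem_Icc] at hi
    exact (((hGm i hi.1).pow 2).mul ((hσmeas i hi.1).pow 2)).mono (ℱ.mono (by omega))
  have hDm : ∀ t s, t ≤ s + 1 → StronglyMeasurable[ℱ s]
      (fun ω => exp (-(ψ * ∑ i ∈ Finset.Icc 1 t, ‖Qinv i ω (X i ω)‖ ^ 2 * σ i ω ^ 2))) :=
    fun t s hts => Real.continuous_exp.comp_stronglyMeasurable ((hWm t s hts).const_mul ψ).neg
  refine ville ℱ (fun t ω => exp (-(ψ *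
        ∑ i ∈ Finset.Icc 1 t, ‖Qinv i ω (X i ω)‖ ^ 2 * σ i ω ^ 2)) *
      cosh (lam * ‖Qinv t ω (∑ i ∈ Finset.Icc 1 t, ε i ω • X i ω)‖)) ?_ ?_ ?_ ha
  · intro t
    refine (hDm t t (by omega)).mul (Real.continuous_cosh.comp_stronglyMeasurable
      (StronglyMeasurable.const_mul ?_ lam))
    exact sm_norm (hAm t t (by omega)) (hQpos t) (hQsq t) (hQinv t) (hMm t)
  · intro ω; simp
  · intro t A hA
    have hsq : ∀ ω, Q (t + 1) ω ∘L Q (t + 1) ω =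
        (ρ • (1 : H →L[ℝ] H) + ∑ i ∈ Finset.Icc 1 t, outerProd (X i ω)) +
          outerProd (X (t + 1) ω) := fun ω => by
      rw [hQsq, Finset.sum_Icc_succ_top (by omega), add_assoc]
    have hnm : ∀ ω, ‖Qinv (t + 1) ω (∑ i ∈ Finset.Icc 1 t, ε i ω • X i ω)‖ ≤
        ‖Qinv t ω (∑ i ∈ Finset.Icc 1 t, ε i ω • X i ω)‖ := fun ω =>
      norm_inv_mono _ (hQpos (t + 1) ω) (hsq ω) (hQpos t ω) (hQsq t ω) (hQinv (t + 1) ω) (hQinv t ω)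
    have hg1 : ∀ ω, ‖Qinv (t + 1) ω (X (t + 1) ω)‖ ≤ 1 := fun ω => by
      refine norm_G_le (hQpos (t + 1) ω) (hsq ω) (fun y => ?_) (hQinv (t + 1) ω)
      rw [← inner_sq (hQpos t ω) (hQsq t ω)]
      positivity
    have hum : StronglyMeasurable[ℱ t]
        (fun ω => ‖Qinv (t + 1) ω (∑ i ∈ Finset.Icc 1 t, ε i ω • X i ω)‖) :=
      sm_norm (hAm (t + 1) t le_rfl) (hQpos _) (hQsq _) (hQinv _) (hMm t)
    have hxm : StronglyMeasurable[ℱ t] (X (t + 1)) := hX (t + 1) (by omega)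
    have him : StronglyMeasurable[ℱ t]
        (fun ω => ⟪Qinv (t + 1) ω (∑ i ∈ Finset.Icc 1 t, ε i ω • X i ω),
          Qinv (t + 1) ω (X (t + 1) ω)⟫) := by
      have := sm_inner_apply (stronglyMeasurable_inverse (hAm (t + 1) t le_rfl)
        (fun ω => (inv_eq (hQsq (t + 1) ω) (hQinv (t + 1) ω)).1)) (hMm t) hxm
      convert this using 2 with ω
      rw [inner_inv (hQpos (t + 1) ω) (hQsq (t + 1) ω) (hQinv (t + 1) ω)]
    have hlum := hum.const_mul lam
    have hsinh := Real.continuous_sinh.comp_stronglyMeasurable hlum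
    have hcosh := Real.continuous_cosh.comp_stronglyMeasurable hlum
    refine le_trans (step1 (μ := μ) (m := ℱ t) (ε := ε (t + 1)) (σ := σ (t + 1))
      (g := fun ω => ‖Qinv (t + 1) ω (X (t + 1) ω)‖)
      (c := fun ω => exp (-(ψ *
          ∑ i ∈ Finset.Icc 1 (t + 1), ‖Qinv i ω (X i ω)‖ ^ 2 * σ i ω ^ 2)) *
        cosh (lam * ‖Qinv (t + 1) ω (∑ i ∈ Finset.Icc 1 t, ε i ω • X i ω)‖))
      (h := fun ω => exp (-(ψ *
          ∑ i ∈ Finset.Icc 1 (t + 1), ‖Qinv i ω (X i ω)‖ ^ 2 * σ i ω ^ 2)) *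
        (sinh (lam * ‖Qinv (t + 1) ω (∑ i ∈ Finset.Icc 1 t, ε i ω • X i ω)‖) /
          (lam * ‖Qinv (t + 1) ω (∑ i ∈ Finset.Icc 1 t, ε i ω • X i ω)‖) *
        (lam ^ 2 * ⟪Qinv (t + 1) ω (∑ i ∈ Finset.Icc 1 t, ε i ω • X i ω),
          Qinv (t + 1) ω (X (t + 1) ω)⟫)))
      (ℱ.le t) hB hlam hlB (hεint _ (by omega)) (hε0 (t + 1) (by omega)) (hmom _)
      (hbern (t + 1) (by omega)) (hσmeas (t + 1) (by omega))
      ((hDm (t + 1) t le_rfl).mul hcosh) (hGm (t + 1) (by omega))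
      ((hDm (t + 1) t le_rfl).mul ((hsinh.measurable.div hlum.measurable).stronglyMeasurable.mul
        (him.const_mul _)))
      (fun ω => by positivity) (fun ω => norm_nonneg _) hg1 (fun ω => by positivity) ?_ hA) ?_
    · intro ω
      rw [Finset.sum_Icc_succ_top (by omega) (fun i => ε i ω • X i ω), map_add, map_smul]
      have hp := cosh_pinelis (Qinv (t + 1) ω (∑ i ∈ Finset.Icc 1 t, ε i ω • X i ω))
        (Qinv (t + 1) ω (X (t + 1) ω)) lam (ε (t + 1) ω) hlam
      refine (mul_le_mul_of_nonneg_left hp (exp_pos _).le).trans (le_of_eq ?_)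
      ring
    · refine lintegral_mono fun ω => ENNReal.ofReal_le_ofReal ?_
      rw [Finset.sum_Icc_succ_top (by omega)]
      rw [← hψ]
      set W := ∑ i ∈ Finset.Icc 1 t, ‖Qinv i ω (X i ω)‖ ^ 2 * σ i ω ^ 2
      set d := ‖Qinv (t + 1) ω (X (t + 1) ω)‖ ^ 2 * σ (t + 1) ω ^ 2
      have h1 : 1 + ψ * d ≤ exp (ψ * d) := by
        rw [add_comm]; exact Real.add_one_le_exp _
      have h2 : cosh (lam * ‖Qinv (t + 1) ω (∑ i ∈ Finset.Icc 1 t, ε i ω • X i ω)‖) ≤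
          cosh (lam * ‖Qinv t ω (∑ i ∈ Finset.Icc 1 t, ε i ω • X i ω)‖) := by
        rw [Real.cosh_le_cosh, abs_of_nonneg (by positivity), abs_of_nonneg (by positivity)]
        exact mul_le_mul_of_nonneg_left (hnm ω) hlam
      have h3 : exp (-(ψ * (W + d))) * exp (ψ * d) = exp (-(ψ * W)) := by
        rw [← Real.exp_add]; congr 1; ring
      set C := cosh (lam * ‖Qinv (t + 1) ω (∑ i ∈ Finset.Icc 1 t, ε i ω • X i ω)‖)
      have hC : 0 ≤ C := (Real.cosh_pos _).le
      calc exp (-(ψ * (W + d))) * C * (1 + ψ * d) ≤ exp (-(ψ * (W + d))) * C * exp (ψ * d) := by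
            gcongr
        _ = exp (-(ψ * W)) * C := by rw [← h3]; ring
        _ ≤ _ := by gcongr

end

theorem stmt_2
    {H : Type*} [NormedAddCommGroup H] [InnerProductSpace ℝ H] [CompleteSpace H]
    [SecondCountableTopology H]
    {Ω : Type*} {m0 : MeasurableSpace Ω} {μ : Measure Ω} [IsProbabilityMeasure μ]
    (ℱ : Filtration ℕ m0)
    (X : ℕ → Ω → H) (ε : ℕ → Ω → ℝ)
    (hX : ∀ t, 1 ≤ t → StronglyMeasurable[ℱ (t - 1)] (X t))
    (hεmeas : ∀ t, 1 ≤ t → StronglyMeasurable[ℱ t] (ε t))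
    (hεint : ∀ t, 1 ≤ t → Integrable (ε t) μ)
    (hε0 : ∀ t, 1 ≤ t → μ[ε t | ℱ (t - 1)] =ᵐ[μ] 0)
    (ρ : ℝ) (hρ : 0 < ρ)
    (Q Qinv : ℕ → Ω → H →L[ℝ] H)
    (hQpos : ∀ t ω, (Q t ω).IsPositive)
    (hQsq : ∀ t ω, Q t ω ∘L Q t ω =
      ρ • (1 : H →L[ℝ] H) + ∑ i ∈ Finset.Icc 1 t, outerProd (X i ω))
    (hQinv : ∀ t ω, Qinv t ω ∘L Q t ω = 1 ∧ Q t ω ∘L Qinv t ω = 1)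
    (B : ℝ) (hB : 0 < B) (σ : ℕ → Ω → ℝ)
    (hσmeas : ∀ t, 1 ≤ t → StronglyMeasurable[ℱ (t - 1)] (σ t))
    (hσ0 : ∀ t ω, 0 ≤ σ t ω)
    (hmom : ∀ t m, Integrable (fun ω => |ε t ω| ^ m) μ)
    (hbern : ∀ t, 1 ≤ t → ∀ m : ℕ, 2 ≤ m →
      μ[fun ω => |ε t ω| ^ m | ℱ (t - 1)] ≤ᵐ[μ]
        fun ω => (1 / 2) * (Nat.factorial m : ℝ) * B ^ (m - 2) * σ t ω ^ 2) :
    ∀ᵐ ω ∂μ,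
      (∀ c : ℝ, ∃ t : ℕ, c ≤ ∑ i ∈ Finset.Icc 1 t, ‖Qinv i ω (X i ω)‖ ^ 2 * σ i ω ^ 2) →
        Filter.limsup (fun t : ℕ =>
            ((‖Qinv t ω (∑ i ∈ Finset.Icc 1 t, ε i ω • X i ω)‖ /
              Real.sqrt (2 * (∑ i ∈ Finset.Icc 1 t, ‖Qinv i ω (X i ω)‖ ^ 2 * σ i ω ^ 2) *
                Real.log (Real.log (∑ i ∈ Finset.Icc 1 t, ‖Qinv i ω (X i ω)‖ ^ 2 * σ i ω ^ 2)))) : EReal))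
          Filter.atTop ≤ 1 := by
  -- almost sure eventual bounds for a fixed `η > 1`
  have hη : ∀ η : ℝ, 1 < η → ∀ᵐ ω ∂μ, ∀ᶠ k : ℕ in atTop, ∀ t,
      √(2 * log (2 * (k:ℝ) ^ η) / η ^ k) *
        ‖Qinv t ω (∑ i ∈ Finset.Icc 1 t, ε i ω • X i ω)‖ ≤
      √(2 * log (2 * (k:ℝ) ^ η) / η ^ k) ^ 2 /
        (2 * (1 - √(2 * log (2 * (k:ℝ) ^ η) / η ^ k) * B)) *
          (∑ i ∈ Finset.Icc 1 t, ‖Qinv i ω (X i ω)‖ ^ 2 * σ i ω ^ 2) +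
        log (2 * (k:ℝ) ^ η) := by
    intro η hη
    have hev : ∀ᶠ k : ℕ in atTop, √(2 * log (2 * (k:ℝ) ^ η) / η ^ k) * B < 1 ∧ 1 ≤ k := by
      have h1 := (lam_tendsto hη).mul_const B
      rw [zero_mul] at h1
      exact (h1.eventually_lt_const one_pos).and (eventually_ge_atTop 1)
    obtain ⟨K, hK⟩ := eventually_atTop.1 hev
    have hsum : ∑' k : ℕ, μ {ω | ∃ t, ((k + K : ℕ) : ℝ) ^ η ≤
        exp (-(√(2 * log (2 * ((k + K : ℕ):ℝ) ^ η) / η ^ (k + K)) ^ 2 /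
          (2 * (1 - √(2 * log (2 * ((k + K : ℕ):ℝ) ^ η) / η ^ (k + K)) * B)) *
          ∑ i ∈ Finset.Icc 1 t, ‖Qinv i ω (X i ω)‖ ^ 2 * σ i ω ^ 2)) *
        cosh (√(2 * log (2 * ((k + K : ℕ):ℝ) ^ η) / η ^ (k + K)) *
          ‖Qinv t ω (∑ i ∈ Finset.Icc 1 t, ε i ω • X i ω)‖)} ≠ ⊤ := by
      have hs : Summable (fun k : ℕ => 1 / ((k + K : ℕ) : ℝ) ^ η) :=
        (summable_nat_add_iff K).2 (Real.summable_one_div_nat_rpow.2 hη)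
      refine ne_top_of_le_ne_top hs.tsum_ofReal_ne_top (ENNReal.tsum_le_tsum fun k => ?_)
      obtain ⟨h1, h2⟩ := hK (k + K) (by omega)
      have h2' : (0:ℝ) < ((k + K : ℕ) : ℝ) := by exact_mod_cast h2
      exact ville_Z ℱ X ε hX hεmeas hεint hε0 ρ hρ Q Qinv hQpos hQsq hQinv B hB σ hσmeas hmom hbern
        _ (Real.sqrt_nonneg _) h1 _ (Real.rpow_pos_of_pos h2' η)
    filter_upwards [ae_eventually_notMem hsum] with ω hω
    rw [← map_add_atTop_eq_nat K, eventually_map]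
    filter_upwards [hω] with k hk t
    obtain ⟨h1, h2⟩ := hK (k + K) (by omega)
    have h2' : (0:ℝ) < ((k + K : ℕ) : ℝ) := by exact_mod_cast h2
    have h3 := Real.rpow_pos_of_pos h2' η
    have hk' := not_le.1 (not_exists.1 hk t)
    set lam := √(2 * log (2 * ((k + K : ℕ):ℝ) ^ η) / η ^ (k + K))
    set ψ := lam ^ 2 / (2 * (1 - lam * B))
    set W := ∑ i ∈ Finset.Icc 1 t, ‖Qinv i ω (X i ω)‖ ^ 2 * σ i ω ^ 2
    set z := ‖Qinv t ω (∑ i ∈ Finset.Icc 1 t, ε i ω • X i ω)‖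
    have h4 : exp (lam * z) / 2 ≤ cosh (lam * z) := by
      rw [Real.cosh_eq]
      have := exp_pos (-(lam * z))
      linarith
    have h5 : exp (lam * z - ψ * W) ≤ 2 * ((k + K : ℕ) : ℝ) ^ η := by
      have e1 : exp (lam * z - ψ * W) = 2 * (exp (-(ψ * W)) * (exp (lam * z) / 2)) := by
        rw [sub_eq_add_neg, Real.exp_add]; ring
      have e2 : exp (-(ψ * W)) * (exp (lam * z) / 2) ≤ exp (-(ψ * W)) * cosh (lam * z) := by
        gcongr
      linarith
    have h6 := (Real.le_log_iff_exp_le (by positivity)).2 h5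
    linarith
  have hall : ∀ᵐ ω ∂μ, ∀ n : ℕ, _ := ae_all_iff.2 fun n : ℕ =>
    hη (1 + 1 / ((n:ℝ) + 1)) (by have : (0:ℝ) < 1 / ((n:ℝ) + 1) := by positivity
                                 linarith)
  filter_upwards [hall] with ω hω hinf
  have hWmono : Monotone (fun t : ℕ => ∑ i ∈ Finset.Icc 1 t, ‖Qinv i ω (X i ω)‖ ^ 2 * σ i ω ^ 2) := by
    intro s t hst
    refine Finset.sum_le_sum_of_subset_of_nonneg (Finset.Icc_subset_Icc_right hst) fun i _ _ => ?_
    positivity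
  have hW : Tendsto (fun t : ℕ => ∑ i ∈ Finset.Icc 1 t, ‖Qinv i ω (X i ω)‖ ^ 2 * σ i ω ^ 2)
      atTop atTop := tendsto_atTop_atTop_of_monotone hWmono hinf
  have hlim : Tendsto (fun n : ℕ => (((1 + 1 / ((n:ℝ) + 1)) ^ 3 : ℝ) : EReal)) atTop (nhds 1) := by
    have h1 : Tendsto (fun n : ℕ => (1 + 1 / ((n:ℝ) + 1)) ^ 3) atTop (nhds 1) := by
      simpa using (tendsto_one_div_add_atTop_nhds_zero_nat (𝕜 := ℝ)).const_add 1 |>.pow 3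
    exact (continuous_coe_real_ereal.tendsto 1).comp h1
  refine ge_of_tendsto' hlim fun n => ?_
  refine Filter.limsup_le_of_le (by isBoundedDefault) ?_
  have hd := det_bound (η := 1 + 1 / ((n:ℝ) + 1))
    (by have : (0:ℝ) < 1 / ((n:ℝ) + 1) := by positivity
        linarith) _ _ hW (hω n)
  filter_upwards [hd] with t ht
  rw [← EReal.coe_div, EReal.coe_le_coe_iff, div_le_iff₀ (Real.sqrt_pos.2 ht.2)]
  exact ht.1
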